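/- For any tree T with m ≥ 1 edges and any k ≥ 2, there exist a constant c > 0 and n₀ such that for all n ≥ n₀, f_k(n,T) ≤ c·n^{(k(m+1)−2)/((k−1)m)}. -/

import Mathlib

open Finset

/-- `c` is a proper edge colouring of the complete graph on `Fin n`:
it is symmetric and edges sharing a vertex receive distinct colours. -/
def IsProperEdgeColoring (n : ℕ) (c : Fin n → Fin n → ℕ) : Prop :=
  (∀ a b, c a b = c b a) ∧
    ∀ a b b', a ≠ b → a ≠ b' → b ≠ b' → c a b ≠ c a b'

/-- The number of colours used by `c` on the edges of the complete graph on `Fin n`. -/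
def numColors (n : ℕ) (c : Fin n → Fin n → ℕ) : ℕ :=
  ((Finset.univ.filter fun p : Fin n × Fin n => p.1 ≠ p.2).image fun p => c p.1 p.2).card

/-- The edge colouring `c` of the complete graph on `Fin n` contains `k` pairwise
vertex-disjoint, pairwise colour-isomorphic copies of `H`. -/
def HasRepeat (n k : ℕ) {V : Type*} (H : SimpleGraph V) (c : Fin n → Fin n → ℕ) : Prop :=
  ∃ φ : Fin k → V → Fin n,
    (∀ i, Function.Injective (φ i)) ∧
    (∀ i j, i ≠ j → ∀ u v, φ i u ≠ φ j v) ∧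
    (∀ i j, ∀ u v, H.Adj u v → c (φ i u) (φ i v) = c (φ j u) (φ j v))

/-- `repeatNumber k n H` is `f_k(n,H)`: the smallest number of colours `C` such that there
is a proper edge colouring of `K_n` with `C` colours containing no `k` pairwise
vertex-disjoint, pairwise colour-isomorphic copies of `H`. -/
noncomputable def repeatNumber (k n : ℕ) {V : Type*} (H : SimpleGraph V) : ℕ :=
  sInf { C | ∃ c : Fin n → Fin n → ℕ,
    IsProperEdgeColoring n c ∧ numColors n c = C ∧ ¬ HasRepeat n k H c }

/-- The functions `f : E → α` avoiding every bad configuration supported inside `S`. -/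
noncomputable def avoiding {E α I : Type*} [Fintype E] [Fintype α] (supp : I → Finset E)
    (Bad : I → (E → α) → Prop) (S : Finset E) : Finset (E → α) := by
  classical exact Finset.univ.filter fun f => ∀ b, supp b ⊆ S → ¬ Bad b f

section Counting

variable {E α I : Type*} [Fintype α]
  {supp : I → Finset E} {Bad : I → (E → α) → Prop}

theorem mem_avoiding [Fintype E] {S : Finset E} {f : E → α} :
    f ∈ avoiding supp Bad S ↔ ∀ b, supp b ⊆ S → ¬ Bad b f := by
  simp [avoiding]

/-- If each function in `X` is determined by its values outside `R`, and recolouring `R`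
arbitrarily maps `X` into `Y`, then `Y` is at least `|α| ^ |R|` times as large as `X`. -/
theorem card_pow_mul_card_le [DecidableEq E] (X Y : Finset (E → α)) (R : Finset E)
    (hdet : ∀ f ∈ X, ∀ g ∈ X, (∀ e, e ∉ R → f e = g e) → f = g)
    (hmap : ∀ f ∈ X, ∀ g, (∀ e, e ∉ R → f e = g e) → g ∈ Y) :
    Fintype.card α ^ R.card * X.card ≤ Y.card := by
  classical
  have hcard : ((Finset.univ : Finset (R → α)) ×ˢ X).card = Fintype.card α ^ R.card * X.card := by
    simp
  rw [← hcard]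
  refine Finset.card_le_card_of_injOn
    (fun p e => if h : e ∈ R then p.1 ⟨e, h⟩ else p.2 e) ?_ ?_
  · rintro ⟨r, f⟩ hp
    simp only [Finset.coe_product, Set.mem_prod, Finset.mem_coe] at hp
    exact hmap f hp.2 _ fun e he => by simp [he]
  · rintro ⟨r, f⟩ hp ⟨r', f'⟩ hp' h
    simp only [Finset.coe_product, Set.mem_prod, Finset.mem_coe] at hp hp'
    have hf : f = f' := hdet f hp.2 f' hp'.2 fun e he => by
      simpa [he] using congrFun h e
    have hr : r = r' := by
      funext ⟨e, he⟩
      simpa [he] using congrFun h e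
    rw [hf, hr]

variable [Fintype E] [DecidableEq E]

theorem pow_mul_card_avoiding_le {r : ℝ} (hr : 0 ≤ r) (U Q : Finset E) (hUQ : Disjoint U Q)
    (h : ∀ S ⊂ U ∪ Q, ∀ e, e ∉ S →
      r * (avoiding supp Bad S).card ≤ (avoiding supp Bad (insert e S)).card) :
    r ^ Q.card * (avoiding supp Bad U).card ≤ (avoiding supp Bad (U ∪ Q)).card := by
  induction Q using Finset.induction_on with
  | empty => simp
  | insert a Q ha ih =>
    rw [Finset.disjoint_insert_right] at hUQ
    have hnot : a ∉ U ∪ Q := by simp [ha, hUQ.1]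
    have hss : U ∪ Q ⊂ U ∪ insert a Q := by
      rw [Finset.union_insert]
      exact Finset.ssubset_insert hnot
    have h1 := ih hUQ.2 fun S hS => h S (hS.trans hss)
    have h2 := h _ hss a hnot
    rw [Finset.card_insert_of_notMem ha, Finset.union_insert, pow_succ']
    calc r * r ^ Q.card * ((avoiding supp Bad U).card : ℝ)
        = r * (r ^ Q.card * (avoiding supp Bad U).card) := by ring
      _ ≤ r * (avoiding supp Bad (U ∪ Q)).card := mul_le_mul_of_nonneg_left h1 hr
      _ ≤ _ := h2

variable [Fintype I]

theorem card_avoiding_insert (w : I → ℕ)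
    (hdep : ∀ b f g, (∀ e ∈ supp b, f e = g e) → Bad b f → Bad b g)
    (hdet : ∀ b, ∀ e ∈ supp b, ∃ R ⊆ supp b, e ∈ R ∧ R.card = w b ∧
      ∀ f g, Bad b f → Bad b g → (∀ x, x ∉ R → f x = g x) → f = g)
    {β : ℝ} (hβ : 0 < β)
    (hsum : ∀ e, β + β * ∑ b with e ∈ supp b, (β⁻¹) ^ w b ≤ Fintype.card α)
    (S : Finset E) (e : E) (he : e ∉ S) :
    β / Fintype.card α * (avoiding supp Bad S).card ≤ (avoiding supp Bad (insert e S)).card := by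
  classical
  induction hn : S.card using Nat.strong_induction_on generalizing S e with
  | _ N ih =>
  subst hn
  set K : ℝ := (Fintype.card α : ℝ) with hK
  have hKpos : 0 < K := by
    have h0 : 0 ≤ β * ∑ b with e ∈ supp b, (β⁻¹) ^ w b := by positivity
    linarith [hsum e]
  have hr : 0 < β / K := by positivity
  let X : I → Finset (E → α) := fun b => (avoiding supp Bad S).filter fun f =>
    Bad b f ∧ supp b ⊆ insert e S
  have hX : ∀ b, e ∈ supp b →
      ((X b).card : ℝ) ≤ β / K * (β⁻¹) ^ w b * (avoiding supp Bad S).card := by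
    intro b hb
    by_cases hsub : supp b ⊆ insert e S
    swap
    · have : X b = ∅ := by simp [X, hsub]
      rw [this]
      simp only [Finset.card_empty, Nat.cast_zero]
      positivity
    obtain ⟨R, hRs, heR, hRc, hRd⟩ := hdet b e hb
    have h1 : Fintype.card α ^ R.card * (X b).card ≤ (avoiding supp Bad (S \ R)).card := by
      refine card_pow_mul_card_le _ _ R ?_ ?_
      · intro f hf g hg
        exact hRd f g (Finset.mem_filter.1 hf).2.1 (Finset.mem_filter.1 hg).2.1
      · intro f hf g hfg
        rw [mem_avoiding]
        intro b' hb' hbad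
        have hf' := mem_avoiding.1 (Finset.mem_filter.1 hf).1
        refine hf' b' (hb'.trans Finset.sdiff_subset) (hdep b' g f (fun x hx => ?_) hbad)
        exact (hfg x (Finset.mem_sdiff.1 (hb' hx)).2).symm
    have hRe : R.erase e ⊆ S := by
      intro x hx
      rw [Finset.mem_erase] at hx
      exact (Finset.mem_insert.1 (hsub (hRs hx.2))).resolve_left hx.1
    have hSR : S \ R ∪ R.erase e = S := by
      ext x
      simp only [Finset.mem_union, Finset.mem_sdiff, Finset.mem_erase]
      constructor
      · rintro (h | h)
        · exact h.1
        · exact hRe (Finset.mem_erase.2 h)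
      · intro hx
        have : x ≠ e := fun h => he (h ▸ hx)
        tauto
    have hdisj : Disjoint (S \ R) (R.erase e) :=
      Finset.disjoint_of_subset_right (Finset.erase_subset _ _) Finset.sdiff_disjoint
    have h2 := pow_mul_card_avoiding_le (supp := supp) (Bad := Bad) hr.le (S \ R) (R.erase e)
      hdisj fun S' hS' a ha => by
        rw [hSR] at hS'
        exact ih _ (Finset.card_lt_card hS') S' a ha rfl
    rw [hSR] at h2
    have hc : w b = (R.erase e).card + 1 := by rw [← hRc, Finset.card_erase_add_one heR]
    have h1' : K ^ w b * (X b).card ≤ (avoiding supp Bad (S \ R)).card := by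
      rw [← hRc]
      rw [hK]
      exact_mod_cast h1
    rw [hc] at h1' ⊢
    set t := (R.erase e).card
    have h3 : (β / K) ^ t * (K ^ (t + 1) * (X b).card) ≤ (avoiding supp Bad S).card :=
      (mul_le_mul_of_nonneg_left h1' (by positivity)).trans h2
    calc ((X b).card : ℝ)
        = β / K * (β⁻¹) ^ (t + 1) * ((β / K) ^ t * (K ^ (t + 1) * (X b).card)) := by
          rw [inv_pow, div_pow]
          field_simp
          ring
      _ ≤ _ := mul_le_mul_of_nonneg_left h3 (by positivity)
  have hcover : avoiding supp Bad S ⊆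
      avoiding supp Bad (insert e S) ∪ (Finset.univ.filter fun b => e ∈ supp b).biUnion X := by
    intro f hf
    rw [Finset.mem_union, or_iff_not_imp_left, mem_avoiding]
    intro h
    push Not at h
    obtain ⟨b, hb, hbad⟩ := h
    refine Finset.mem_biUnion.2 ⟨b, ?_, Finset.mem_filter.2 ⟨hf, hbad, hb⟩⟩
    simp only [Finset.mem_filter, Finset.mem_univ, true_and]
    by_contra heb
    refine mem_avoiding.1 hf b (fun x hx => ?_) hbad
    exact (Finset.mem_insert.1 (hb hx)).resolve_left fun h => heb (h ▸ hx)
  have hcard : ((avoiding supp Bad S).card : ℝ) ≤ (avoiding supp Bad (insert e S)).card +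
      ∑ b with e ∈ supp b, ((X b).card : ℝ) := by
    have := (Finset.card_le_card hcover).trans ((Finset.card_union_le _ _).trans
      (Nat.add_le_add_left Finset.card_biUnion_le _))
    exact_mod_cast this
  have hXsum : ∑ b with e ∈ supp b, ((X b).card : ℝ) ≤
      (β * ∑ b with e ∈ supp b, (β⁻¹) ^ w b) / K * (avoiding supp Bad S).card := by
    calc _ ≤ ∑ b with e ∈ supp b, β / K * (β⁻¹) ^ w b * (avoiding supp Bad S).card :=
          Finset.sum_le_sum fun b hb => hX b (Finset.mem_filter.1 hb).2
      _ = _ := by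
          rw [← Finset.sum_mul, ← Finset.mul_sum]
          ring
  have hle : (β * ∑ b with e ∈ supp b, (β⁻¹) ^ w b) / K ≤ 1 - β / K := by
    rw [div_le_iff₀ hKpos, sub_mul, div_mul_cancel₀ _ hKpos.ne']
    linarith [hsum e]
  have := mul_le_mul_of_nonneg_right hle (Nat.cast_nonneg (α := ℝ) (avoiding supp Bad S).card)
  linarith

/-- A counting form of the local lemma: if, weighted by `β ^ (-w)`, few bad configurations
pass through each point, then some function avoids all of them. -/
theorem exists_avoiding_all (w : I → ℕ)
    (hne : ∀ b, (supp b).Nonempty)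
    (hdep : ∀ b f g, (∀ e ∈ supp b, f e = g e) → Bad b f → Bad b g)
    (hdet : ∀ b, ∀ e ∈ supp b, ∃ R ⊆ supp b, e ∈ R ∧ R.card = w b ∧
      ∀ f g, Bad b f → Bad b g → (∀ x, x ∉ R → f x = g x) → f = g)
    {β : ℝ} (hβ : 0 < β) [Nonempty α]
    (hsum : ∀ e, β + β * ∑ b with e ∈ supp b, (β⁻¹) ^ w b ≤ Fintype.card α) :
    ∃ f : E → α, ∀ b, ¬ Bad b f := by
  classical
  have hK : (0 : ℝ) < Fintype.card α := by exact_mod_cast Fintype.card_pos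
  have h := pow_mul_card_avoiding_le (supp := supp) (Bad := Bad) (div_pos hβ hK).le ∅ Finset.univ
    (Finset.disjoint_empty_left _) fun S _ e he =>
      card_avoiding_insert w hdep hdet hβ hsum S e he
  have h0 : (avoiding supp Bad ∅).Nonempty := by
    obtain ⟨a⟩ := ‹Nonempty α›
    refine ⟨fun _ => a, mem_avoiding.2 fun b hb => ?_⟩
    exact absurd (Finset.subset_empty.1 hb) (hne b).ne_empty
  have h1 : (0 : ℝ) < (avoiding supp Bad ∅).card := by exact_mod_cast h0.card_pos
  have h2 : (0 : ℝ) < (avoiding supp Bad (∅ ∪ Finset.univ)).card :=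
    lt_of_lt_of_le (mul_pos (pow_pos (div_pos hβ hK) _) h1) h
  obtain ⟨f, hf⟩ := Finset.card_pos.1 (by exact_mod_cast h2)
  exact ⟨f, fun b => mem_avoiding.1 hf b (by simp)⟩

end Counting

/-- Few embeddings send a given pair of points onto a given unordered pair. -/
theorem card_embedding_sym2_le {J : Type*} [Fintype J] [DecidableEq J] (n : ℕ) {p q : J}
    (hpq : p ≠ q) (e : Sym2 (Fin n)) :
    (Finset.univ.filter fun φ : J ↪ Fin n => s(φ p, φ q) = e).card
      ≤ 2 * n ^ (Fintype.card J - 2) := by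
  have hc : Fintype.card {j : J // j ≠ p ∧ j ≠ q} = Fintype.card J - 2 := by
    rw [Fintype.card_subtype]
    have : (Finset.univ.filter fun j : J => j ≠ p ∧ j ≠ q) = ({p, q} : Finset J)ᶜ := by
      ext j
      simp
    rw [this, Finset.card_compl, Finset.card_pair hpq]
  have hT : (Finset.univ : Finset (Bool × ({j : J // j ≠ p ∧ j ≠ q} → Fin n))).card
      = 2 * n ^ (Fintype.card J - 2) := by
    rw [Finset.card_univ, Fintype.card_prod, Fintype.card_fun, hc]
    simp
  rw [← hT]
  induction e using Sym2.ind with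
  | _ x y =>
  refine Finset.card_le_card_of_injOn
    (fun φ => (decide (φ p = x ∧ φ q = y), fun j => φ j.1)) (fun _ _ => by simp) ?_
  intro φ hφ ψ hψ h
  simp only [Finset.coe_filter, Finset.mem_univ, true_and, Set.mem_ofPred_eq, Sym2.eq_iff] at hφ hψ
  simp only [Prod.mk.injEq, decide_eq_decide] at h
  obtain ⟨h1, h2⟩ := h
  ext j : 1
  by_cases hj : j = p
  · subst hj
    grind
  by_cases hj' : j = q
  · subst hj'
    grind
  exact congrFun h2 ⟨j, hj, hj'⟩

theorem card_embedding_exists_sym2_le {J : Type*} [Fintype J] [DecidableEq J] (n : ℕ)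
    (P : Finset (Sym2 J)) (hP : ∀ s ∈ P, ¬ s.IsDiag) (e : Sym2 (Fin n)) :
    (Finset.univ.filter fun φ : J ↪ Fin n => e ∈ P.image (Sym2.map φ)).card
      ≤ P.card * (2 * n ^ (Fintype.card J - 2)) := by
  have : (Finset.univ.filter fun φ : J ↪ Fin n => e ∈ P.image (Sym2.map φ)) ⊆
      P.biUnion fun s => Finset.univ.filter fun φ : J ↪ Fin n => Sym2.map φ s = e := by
    intro φ
    simp
  refine (Finset.card_le_card this).trans (Finset.card_biUnion_le_card_mul _ _ _ ?_)
  intro s hs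
  have hd := hP s hs
  induction s using Sym2.ind with
  | _ p q => exact card_embedding_sym2_le n (by simpa using hd) e

theorem injective_sym2_map_prodMk {κ V : Type*} :
    Function.Injective fun p : κ × Sym2 V => Sym2.map (Prod.mk p.1) p.2 := by
  rintro ⟨i, s⟩ ⟨j, t⟩ h
  induction s using Sym2.ind with
  | _ a b =>
  induction t using Sym2.ind with
  | _ c d =>
  simp only [Sym2.map_mk, Sym2.eq_iff, Prod.mk.injEq] at h
  simp only [Prod.mk.injEq, Sym2.eq_iff]
  tauto

/-- The edges of the copies of `F` indexed by `A`. -/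
def copyEdges {κ V : Type*} [DecidableEq κ] [DecidableEq V] (A : Finset κ) (F : Finset (Sym2 V)) :
    Finset (Sym2 (κ × V)) :=
  (A ×ˢ F).image fun p => Sym2.map (Prod.mk p.1) p.2

theorem card_copyEdges {κ V : Type*} [DecidableEq κ] [DecidableEq V] (A : Finset κ)
    (F : Finset (Sym2 V)) : (copyEdges A F).card = A.card * F.card := by
  rw [copyEdges, Finset.card_image_of_injective _ injective_sym2_map_prodMk,
    Finset.card_product]

theorem exists_sym2_coloring {V : Type*} [Fintype V] [DecidableEq V] (n k K : ℕ)
    (F : Finset (Sym2 V)) (hF : ∀ s ∈ F, ¬ s.IsDiag) (hFne : F.Nonempty) (hk : 2 ≤ k)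
    (hK : 0 < K) {β : ℝ} (hβ : 0 < β)
    (hsum : β + (4 * n + β * (k * F.card * (2 * n ^ (k * Fintype.card V - 2)) *
      (β⁻¹) ^ ((k - 1) * F.card))) ≤ K) :
    ∃ f : Sym2 (Fin n) → Fin K,
      (∀ φ : Fin 3 ↪ Fin n, f s(φ 0, φ 1) ≠ f s(φ 0, φ 2)) ∧
      ∀ φ : Fin k × V ↪ Fin n, ¬ ∀ i j, ∀ s ∈ F,
        f (Sym2.map φ (Sym2.map (Prod.mk i) s)) = f (Sym2.map φ (Sym2.map (Prod.mk j) s)) := by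
  classical
  let P : Finset (Sym2 (Fin 3)) := {s(0, 1), s(0, 2)}
  let Q : Finset (Sym2 (Fin k × V)) := copyEdges Finset.univ F
  let supp : (Fin 3 ↪ Fin n) ⊕ (Fin k × V ↪ Fin n) → Finset (Sym2 (Fin n)) :=
    Sum.elim (fun φ => P.image (Sym2.map φ)) (fun φ => Q.image (Sym2.map φ))
  let Bad : (Fin 3 ↪ Fin n) ⊕ (Fin k × V ↪ Fin n) → (Sym2 (Fin n) → Fin K) → Prop :=
    Sum.elim (fun φ f => f s(φ 0, φ 1) = f s(φ 0, φ 2)) (fun φ f => ∀ i j, ∀ s ∈ F,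
        f (Sym2.map φ (Sym2.map (Prod.mk i) s)) = f (Sym2.map φ (Sym2.map (Prod.mk j) s)))
  let w : (Fin 3 ↪ Fin n) ⊕ (Fin k × V ↪ Fin n) → ℕ :=
    Sum.elim (fun _ => 1) (fun _ => (k - 1) * F.card)
  have hmemQ : ∀ i, ∀ s ∈ F, Sym2.map (Prod.mk i) s ∈ Q := fun i s hs =>
    Finset.mem_image.2 ⟨(i, s), by simp [hs], rfl⟩
  have : Nonempty (Fin K) := ⟨⟨0, hK⟩⟩
  suffices h : ∃ f, ∀ b, ¬ Bad b f by
    obtain ⟨f, hf⟩ := h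
    exact ⟨f, fun φ => hf (Sum.inl φ), fun φ => hf (Sum.inr φ)⟩
  refine exists_avoiding_all (supp := supp) w ?_ ?_ ?_ hβ ?_
  · rintro (φ | φ)
    · simp [supp, P]
    · obtain ⟨s, hs⟩ := hFne
      exact ⟨_, Finset.mem_image_of_mem _ (hmemQ ⟨0, by omega⟩ s hs)⟩
  · rintro (φ | φ) f g hfg h
    · simp only [supp, P, Bad, Sum.elim_inl] at hfg h ⊢
      rw [← hfg _ (by simp), ← hfg _ (by simp), h]
    · simp only [supp, Bad, Sum.elim_inr] at hfg h ⊢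
      intro i j s hs
      rw [← hfg _ (Finset.mem_image_of_mem _ (hmemQ i s hs)),
        ← hfg _ (Finset.mem_image_of_mem _ (hmemQ j s hs)), h i j s hs]
  · rintro (φ | φ) e he
    · refine ⟨{e}, by simpa using he, by simp, by simp [w], fun f g hf hg hfg => ?_⟩
      simp only [Bad, Sum.elim_inl] at hf hg
      simp only [Finset.mem_singleton] at hfg
      have hne : s(φ 0, φ 1) ≠ s(φ 0, φ 2) := by
        simp
      simp only [supp, P, Sum.elim_inl, Finset.mem_image, Finset.mem_insert,
        Finset.mem_singleton, exists_eq_or_imp, exists_eq_left, Sym2.map_mk] at he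
      funext x
      by_cases hx : x = e
      · subst hx
        rcases he with rfl | rfl
        · rw [hf, hg, hfg _ hne.symm]
        · rw [← hf, ← hg, hfg _ hne]
      · exact hfg x hx
    · simp only [supp, Sum.elim_inr, Q, copyEdges, Finset.mem_image, Finset.mem_product,
        Finset.mem_univ, true_and, Prod.exists] at he
      obtain ⟨-, ⟨i, s, hs, rfl⟩, rfl⟩ := he
      have : Nontrivial (Fin k) := Fin.nontrivial_iff_two_le.2 hk
      obtain ⟨j, hj⟩ := exists_ne i
      refine ⟨(copyEdges (Finset.univ.erase j) F).image (Sym2.map φ), ?_, ?_, ?_, ?_⟩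
      · exact Finset.image_subset_image (Finset.image_subset_image
          (Finset.product_subset_product_left (Finset.erase_subset _ _)))
      · exact Finset.mem_image_of_mem _ (Finset.mem_image.2 ⟨(i, s), by simp [hs, hj.symm], rfl⟩)
      · rw [Finset.card_image_of_injective _ (Sym2.map.injective φ.injective), card_copyEdges]
        simp [w]
      · intro f g hf hg hfg
        simp only [Bad, Sum.elim_inr] at hf hg
        funext x
        by_cases hx : x ∈ (copyEdges (Finset.univ.erase j) F).image (Sym2.map φ)
        · simp only [copyEdges, Finset.mem_image, Finset.mem_product, Prod.exists] at hx
          obtain ⟨-, ⟨i', t, ⟨-, ht⟩, rfl⟩, rfl⟩ := hx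
          rw [hf i' j t ht, hg i' j t ht]
          refine hfg _ fun hmem => ?_
          obtain ⟨y, hy, hy'⟩ := Finset.mem_image.1 hmem
          obtain ⟨⟨i₁, t₁⟩, h₁, rfl⟩ := Finset.mem_image.1 hy
          have h₂ := injective_sym2_map_prodMk (a₁ := (i₁, t₁)) (a₂ := (j, t))
            (Sym2.map.injective φ.injective hy')
          simp only [Prod.mk.injEq] at h₂
          simp [h₂.1] at h₁
        · exact hfg x hx
  · intro e
    have h1 := card_embedding_exists_sym2_le n P (by simp [P]) e
    have h2 := card_embedding_exists_sym2_le n Q (by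
      intro x hx
      obtain ⟨⟨i, s⟩, h, rfl⟩ := Finset.mem_image.1 hx
      rw [Sym2.isDiag_map (Prod.mk_right_injective i)]
      exact hF s (Finset.mem_product.1 h).2) e
    have hPc : P.card = 2 := by decide
    rw [hPc, Fintype.card_fin] at h1
    rw [card_copyEdges, Finset.card_univ, Fintype.card_fin, Fintype.card_prod,
      Fintype.card_fin] at h2
    have h1' : ((Finset.univ.filter fun φ : Fin 3 ↪ Fin n =>
        e ∈ P.image (Sym2.map φ)).card : ℝ) ≤ 4 * n := by
      have : 2 * (2 * n ^ (3 - 2)) = 4 * n := by norm_num; ring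
      rw [this] at h1
      exact_mod_cast h1
    have h2' : ((Finset.univ.filter fun φ : Fin k × V ↪ Fin n =>
        e ∈ Q.image (Sym2.map φ)).card : ℝ) ≤
        k * F.card * (2 * n ^ (k * Fintype.card V - 2)) := by
      exact_mod_cast h2
    have hS : ∑ b with e ∈ supp b, (β⁻¹) ^ w b =
        (Finset.univ.filter fun φ : Fin 3 ↪ Fin n => e ∈ P.image (Sym2.map φ)).card * β⁻¹ +
        (Finset.univ.filter fun φ : Fin k × V ↪ Fin n => e ∈ Q.image (Sym2.map φ)).card *
          (β⁻¹) ^ ((k - 1) * F.card) := by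
      rw [Finset.sum_filter, Fintype.sum_sum_type]
      change (∑ φ : Fin 3 ↪ Fin n, if e ∈ P.image (Sym2.map φ) then (β⁻¹) ^ 1 else 0) +
        (∑ φ : Fin k × V ↪ Fin n, if e ∈ Q.image (Sym2.map φ) then
          (β⁻¹) ^ ((k - 1) * F.card) else 0) = _
      rw [← Finset.sum_filter, ← Finset.sum_filter, Finset.sum_const, Finset.sum_const]
      simp [nsmul_eq_mul]
    rw [hS, Fintype.card_fin, mul_add]
    refine le_trans ?_ hsum
    rw [mul_comm β (_ * β⁻¹), inv_mul_cancel_right₀ hβ.ne']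
    gcongr

theorem repeatNumber_le_of_sym2_coloring {V : Type*} (H : SimpleGraph V) (n k K : ℕ)
    (f : Sym2 (Fin n) → Fin K)
    (hproper : ∀ φ : Fin 3 ↪ Fin n, f s(φ 0, φ 1) ≠ f s(φ 0, φ 2))
    (hrep : ∀ φ : Fin k × V ↪ Fin n, ¬ ∀ i j, ∀ s ∈ H.edgeSet,
      f (Sym2.map φ (Sym2.map (Prod.mk i) s)) = f (Sym2.map φ (Sym2.map (Prod.mk j) s))) :
    repeatNumber k n H ≤ K := by
  let c : Fin n → Fin n → ℕ := fun a b => f s(a, b)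
  have hc : repeatNumber k n H ≤ numColors n c := by
    refine Nat.sInf_le ⟨c, ⟨fun a b => by simp [c, Sym2.eq_swap], ?_⟩, rfl, ?_⟩
    · intro a b b' h1 h2 h3 h
      refine hproper ⟨![a, b, b'], ?_⟩ (Fin.ext h)
      intro i j hij
      fin_cases i <;> fin_cases j <;> simp_all
    · rintro ⟨φ, hinj, hdisj, hcol⟩
      refine hrep ⟨fun p => φ p.1 p.2, ?_⟩ ?_
      · rintro ⟨i, u⟩ ⟨j, v⟩ h
        by_cases hij : i = j
        · subst hij
          exact Prod.ext rfl (hinj i h)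
        · exact absurd h (hdisj i j hij u v)
      · intro i j s hs
        induction s using Sym2.ind with
        | _ u v => exact Fin.ext (hcol i j u v hs)
  refine hc.trans ?_
  calc numColors n c ≤ (Finset.range K).card := Finset.card_le_card fun x hx => by
        obtain ⟨p, -, rfl⟩ := Finset.mem_image.1 hx
        simp [c]
    _ = K := Finset.card_range K

/-- For any tree `T` with `m ≥ 1` edges and any `k ≥ 2`,
`f_k(n,T) = O(n^{(k(m+1)-2)/((k-1)m)})`. -/
theorem stmt_15 (V : Type) [Fintype V] [DecidableEq V] (T : SimpleGraph V)
    [DecidableRel T.Adj] (hT : T.IsTree) (m : ℕ) (hm : 1 ≤ m)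
    (hme : T.edgeFinset.card = m) (k : ℕ) (hk : 2 ≤ k) :
    ∃ c : ℝ, 0 < c ∧ ∃ n₀ : ℕ, ∀ n ≥ n₀,
      (repeatNumber k n T : ℝ) ≤
        c * (n : ℝ) ^ (((k : ℝ) * ((m : ℝ) + 1) - 2) / (((k : ℝ) - 1) * (m : ℝ))) := by
  have hV : Fintype.card V = m + 1 := by rw [← hT.card_edgeFinset, hme]
  set x : ℝ := ((k : ℝ) * ((m : ℝ) + 1) - 2) / (((k : ℝ) - 1) * (m : ℝ)) with hx
  have hk' : (2 : ℝ) ≤ k := by exact_mod_cast hk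
  have hm' : (1 : ℝ) ≤ m := by exact_mod_cast hm
  have hL0 : (0 : ℝ) < ((k : ℝ) - 1) * m := mul_pos (by linarith) (by linarith)
  have hx1 : 1 ≤ x := by
    rw [hx, one_le_div hL0]
    linarith
  set A : ℝ := 8 * k * m + 16 with hA
  have hA0 : 0 < A := by positivity
  refine ⟨A + 1, by positivity, 1, fun n hn => ?_⟩
  have hn' : (1 : ℝ) ≤ n := by exact_mod_cast hn
  have hnx : (n : ℝ) ≤ (n : ℝ) ^ x := by
    simpa using Real.rpow_le_rpow_of_exponent_le hn' hx1
  set y : ℝ := (n : ℝ) ^ x with hy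
  have hy1 : 1 ≤ y := hn'.trans hnx
  have hyL : y ^ ((k - 1) * m) = (n : ℝ) ^ (k * (m + 1) - 2) := by
    have h2 : 2 ≤ k * (m + 1) := by nlinarith
    rw [hy, ← Real.rpow_natCast, ← Real.rpow_mul (by positivity), ← Real.rpow_natCast]
    congr 1
    push_cast [Nat.cast_sub h2, Nat.cast_sub (show 1 ≤ k by omega)]
    rw [hx, div_mul_cancel₀ _ hL0.ne']
  have hKle : (⌈A * y⌉₊ : ℝ) ≤ (A + 1) * y := by
    have := Nat.ceil_lt_add_one (a := A * y) (by positivity)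
    linarith
  have hK0 : 0 < ⌈A * y⌉₊ := Nat.ceil_pos.2 (by positivity)
  have hL : (k - 1) * m ≠ 0 := by
    have : 1 ≤ k - 1 := by omega
    positivity
  have hsum : A * y / 2 + (4 * n + A * y / 2 * (k * T.edgeFinset.card *
      (2 * n ^ (k * Fintype.card V - 2)) * ((A * y / 2)⁻¹) ^ ((k - 1) * T.edgeFinset.card)))
      ≤ (⌈A * y⌉₊ : ℝ) := by
    refine le_trans ?_ (Nat.le_ceil _)
    rw [hme, hV, ← hyL, inv_pow]
    have hpow : A / 2 * y ^ ((k - 1) * m) ≤ (A * y / 2) ^ ((k - 1) * m) := by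
      rw [mul_div_right_comm, mul_pow]
      gcongr
      refine le_self_pow₀ ?_ hL
      rw [hA]
      nlinarith
    have hhalf : k * m * (2 * y ^ ((k - 1) * m)) * ((A * y / 2) ^ ((k - 1) * m))⁻¹ ≤ 1 / 2 := by
      rw [← div_eq_mul_inv, div_le_iff₀ (by positivity)]
      have : 0 ≤ y ^ ((k - 1) * m) := by positivity
      rw [hA] at hpow ⊢
      nlinarith
    have h4 : 4 * (n : ℝ) ≤ A * y / 4 := by
      have : 16 * y ≤ A * y := by
        gcongr
        rw [hA]
        have : (0 : ℝ) ≤ 8 * k * m := by positivity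
        linarith
      linarith
    have h5 := mul_le_mul_of_nonneg_left hhalf (show 0 ≤ A * y / 2 by positivity)
    linarith
  obtain ⟨f, hf1, hf2⟩ := exists_sym2_coloring n k ⌈A * y⌉₊ T.edgeFinset
    (fun s hs => T.not_isDiag_of_mem_edgeFinset hs) (Finset.card_pos.1 (by omega)) hk hK0
    (by positivity) hsum
  have hle := repeatNumber_le_of_sym2_coloring T n k _ f hf1 fun φ h =>
    hf2 φ fun i j s hs => h i j s (SimpleGraph.mem_edgeFinset.1 hs)
  exact le_trans (by exact_mod_cast hle) hKle
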